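/- arXiv:1906.09377 — 4 statements merged into one kernel-verified Lean document; each statement's English description precedes it below -/
import Mathlib

section
/- For every real x with 0 ≤ x ≤ 1, the series Σ_{k=1}^{∞} (k^{k−1}/k!) x^{k−1} e^{−kx} converges and equals 1. -/
open Real

noncomputable def tlc (k : ℕ) : ℝ := ((k : ℝ) + 1) ^ k / (Nat.factorial (k + 1))

lemma tlc_nonneg (k : ℕ) : 0 ≤ tlc k := by unfold tlc; positivity

lemma tlc_le (k : ℕ) : tlc k ≤ Real.exp 1 * Real.exp 1 ^ k := by
  have h := Real.pow_div_factorial_le_exp (x := (k : ℝ) + 1) (by positivity) k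
  have h2 : tlc k ≤ ((k : ℝ) + 1) ^ k / (Nat.factorial k) := by
    unfold tlc
    gcongr
    omega
  have h3 : Real.exp ((k : ℝ) + 1) = Real.exp 1 * Real.exp 1 ^ k := by
    rw [← Real.exp_nat_mul, ← Real.exp_add]; congr 1; ring
  linarith

lemma tlc_summable (y : ℝ) (hy0 : 0 ≤ y) (hy : Real.exp 1 * y < 1) :
    Summable (fun k => tlc k * y ^ k) := by
  refine Summable.of_nonneg_of_le (fun k => mul_nonneg (tlc_nonneg k) (by positivity)) (fun k => ?_)
    ((summable_geometric_of_lt_one (by positivity) hy).mul_left (Real.exp 1))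
  rw [mul_pow, ← mul_assoc]
  exact mul_le_mul_of_nonneg_right (tlc_le k) (by positivity)

lemma tl_fd (n : ℕ) :
    ∑ k ∈ Finset.range (n + 1), ((-1 : ℝ) ^ (n - k) * (n + 1).choose (k + 1)) * ((k : ℝ) + 1) ^ n
      = if n = 0 then 1 else 0 := by
  have h := congrFun (fwdDiff_iter_pow_eq_zero_of_lt (R := ℝ) (Nat.lt_succ_self n)) 0
  rw [fwdDiff_iter_eq_sum_shift, Finset.sum_range_succ'] at h
  rcases Nat.eq_zero_or_pos n with rfl | hn
  · simp
  · simp [hn.ne'] at h ⊢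
    exact h

lemma tl_anti (x : ℝ) (n : ℕ) :
    ∑ p ∈ Finset.HasAntidiagonal.antidiagonal n,
      tlc p.1 * x ^ p.1 * ((-((p.1 + 1) * x)) ^ p.2 / (Nat.factorial p.2)) =
      if n = 0 then 1 else 0 := by
  rw [Finset.Nat.sum_antidiagonal_eq_sum_range_succ
    (fun k m => tlc k * x ^ k * ((-(((k : ℝ) + 1) * x)) ^ m / (Nat.factorial m))) n]
  have key : ∀ k ∈ Finset.range (n + 1),
      tlc k * x ^ k * ((-(((k : ℝ) + 1) * x)) ^ (n - k) / (Nat.factorial (n - k)))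
      = (x ^ n / (Nat.factorial (n + 1))) *
        (((-1 : ℝ) ^ (n - k) * (n + 1).choose (k + 1)) * ((k : ℝ) + 1) ^ n) := by
    intro k hk
    have hk' : k ≤ n := by simpa [Nat.lt_succ_iff] using hk
    obtain ⟨m, rfl⟩ := Nat.exists_eq_add_of_le hk'
    have h1 : k + m - k = m := by omega
    rw [h1]
    have hc : (((k + m + 1).choose (k + 1) : ℕ) : ℝ) =
        (Nat.factorial (k + m + 1)) / ((Nat.factorial (k + 1)) * (Nat.factorial m)) := by
      rw [Nat.cast_choose ℝ (by omega)]
      congr 4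
      omega
    rw [hc, tlc, neg_eq_neg_one_mul, mul_pow, mul_pow, pow_add, pow_add]
    have := Nat.factorial_ne_zero (k + m + 1)
    field_simp
  rw [Finset.sum_congr rfl key, ← Finset.mul_sum, tl_fd]
  split_ifs with h
  · subst h; simp
  · simp

lemma tl_small (x : ℝ) (h0 : 0 ≤ x) (h1 : x ≤ 1 / 8) :
    HasSum (fun k : ℕ => tlc k * x ^ k * Real.exp (-((k + 1) * x))) 1 := by
  have hexp : ∀ z : ℝ, HasSum (fun m : ℕ => z ^ m / (Nat.factorial m)) (Real.exp z) := by
    intro z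
    rw [Real.exp_eq_exp_ℝ]
    exact NormedSpace.expSeries_div_hasSum_exp z
  set F : ℕ × ℕ → ℝ := fun p =>
    tlc p.1 * x ^ p.1 * ((-((p.1 + 1) * x)) ^ p.2 / (Nat.factorial p.2)) with hF
  have hlt : Real.exp 1 * (x * Real.exp x) < 1 := by
    have e1 := Real.exp_one_lt_d9
    have e2 : Real.exp x ≤ Real.exp 1 := Real.exp_le_exp.2 (by linarith)
    have e3 : 0 < Real.exp x := Real.exp_pos x
    have : x * Real.exp x ≤ 1 / 8 * 2.7182818286 := by
      apply mul_le_mul h1 (by linarith) e3.le (by norm_num)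
    have : Real.exp 1 * (x * Real.exp x) ≤ 2.7182818286 * (1 / 8 * 2.7182818286) := by
      apply mul_le_mul e1.le this (by positivity) (by norm_num)
    norm_num at this ⊢
    linarith
  have hnorm : ∀ k m : ℕ, ‖F (k, m)‖ =
      tlc k * x ^ k * ((((k : ℝ) + 1) * x) ^ m / (Nat.factorial m)) := by
    intro k m
    have a1 : |tlc k| = tlc k := abs_of_nonneg (tlc_nonneg k)
    have a2 : |(k : ℝ) + 1| = k + 1 := abs_of_nonneg (by positivity)
    simp only [hF, Real.norm_eq_abs, abs_mul, abs_div, abs_pow, abs_neg, a1, a2, abs_of_nonneg h0,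
      Nat.abs_cast]
  have hsF : Summable F := by
    apply Summable.of_norm
    rw [summable_prod_of_nonneg (fun _ => norm_nonneg _)]
    constructor
    · intro k
      simp only [hnorm]
      exact ((hexp _).summable).mul_left _
    · simp only [hnorm]
      have : ∀ k : ℕ, ∑' m : ℕ, tlc k * x ^ k * ((((k : ℝ) + 1) * x) ^ m / (Nat.factorial m))
          = Real.exp x * (tlc k * (x * Real.exp x) ^ k) := by
        intro k
        rw [tsum_mul_left, (hexp _).tsum_eq, mul_pow, ← Real.exp_nat_mul, add_mul, Real.exp_add,
          one_mul]
        ring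
      simp only [this]
      exact (tlc_summable _ (by positivity) hlt).mul_left _
  have hA := hsF.hasSum
  have hB : HasSum (fun n : ℕ => if n = 0 then (1 : ℝ) else 0) (∑' p, F p) := by
    have := (Finset.HasAntidiagonal.sigmaAntidiagonalEquivProd (A := ℕ)).hasSum_iff.2 hA
    refine this.sigma (fun n => ?_)
    have h2 := hasSum_fintype
      (fun p : Finset.HasAntidiagonal.antidiagonal n => F p)
    have h3 : ∑ p : Finset.HasAntidiagonal.antidiagonal n, F p = if n = 0 then (1 : ℝ) else 0 := by
      rw [Finset.sum_coe_sort (Finset.HasAntidiagonal.antidiagonal n) F, ← tl_anti x n]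
    rw [h3] at h2
    exact h2
  have h1' : ∑' p, F p = 1 := hB.unique (hasSum_ite_eq 0 1)
  rw [h1'] at hA
  exact hA.prod_fiberwise (fun k => (hexp _).mul_left _)

noncomputable def tlG (y : ℝ) : ℝ := ∑' k, tlc k * y ^ k

lemma tl_lt (x : ℝ) (h1 : x ≠ 1) : Real.exp 1 * (x * Real.exp (-x)) < 1 := by
  have h := Real.add_one_lt_exp (x := x - 1) (sub_ne_zero.2 h1)
  have : Real.exp 1 * (x * Real.exp (-x)) = x / Real.exp (x - 1) := by
    rw [Real.exp_sub, Real.exp_neg]; field_simp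
  rw [this, div_lt_one (Real.exp_pos _)]
  linarith

lemma tlG_analytic (y : ℝ) (hy0 : 0 ≤ y) (hy : Real.exp 1 * y < 1) : AnalyticAt ℝ tlG y := by
  obtain ⟨r, hrv⟩ : ∃ r : NNReal, (r : ℝ) = Real.exp (-1) := ⟨⟨_, (Real.exp_pos _).le⟩, rfl⟩
  have hr : (r : ENNReal) ≤
      (FormalMultilinearSeries.ofScalars ℝ tlc).radius := by
    apply FormalMultilinearSeries.le_radius_of_bound _ (Real.exp 1)
    intro n
    rw [FormalMultilinearSeries.ofScalars_norm, Real.norm_eq_abs, abs_of_nonneg (tlc_nonneg n), hrv]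
    calc tlc n * Real.exp (-1) ^ n ≤ (Real.exp 1 * Real.exp 1 ^ n) * Real.exp (-1) ^ n :=
          mul_le_mul_of_nonneg_right (tlc_le n) (by positivity)
      _ = Real.exp 1 := by
          rw [mul_assoc, ← mul_pow, ← Real.exp_add]; simp
  have hp : 0 < (FormalMultilinearSeries.ofScalars ℝ tlc).radius := by
    refine lt_of_lt_of_le ?_ hr
    rw [ENNReal.coe_pos, ← NNReal.coe_pos, hrv]
    exact Real.exp_pos _
  have hG : tlG = (FormalMultilinearSeries.ofScalars ℝ tlc).sum := by
    have := FormalMultilinearSeries.ofScalarsSum_eq_tsum (E := ℝ) tlc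
    funext z
    have := congrFun this z
    simp only [FormalMultilinearSeries.ofScalarsSum, smul_eq_mul] at this
    rw [this, tlG]
  rw [hG]
  apply (FormalMultilinearSeries.hasFPowerSeriesOnBall _ hp).analyticAt_of_mem
  refine Metric.eball_subset_eball hr ?_
  rw [Metric.eball_coe, mem_ball_zero_iff, Real.norm_eq_abs, abs_of_nonneg hy0]
  rw [hrv, Real.exp_neg, ← one_div, lt_div_iff₀ (Real.exp_pos 1)]
  linarith

lemma tlG_Ioo (x : ℝ) (hx : x ∈ Set.Ioo (0 : ℝ) 1) : tlG (x * Real.exp (-x)) = Real.exp x := by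
  have hf : AnalyticOnNhd ℝ (fun x => tlG (x * Real.exp (-x))) (Set.Ioo 0 1) := by
    intro z hz
    have hz0 := hz.1
    have := tlG_analytic (z * Real.exp (-z)) (by positivity) (tl_lt z hz.2.ne)
    exact this.fun_comp (f := fun x => x * Real.exp (-x)) (by fun_prop)
  have hg : AnalyticOnNhd ℝ (fun x => Real.exp x) (Set.Ioo 0 1) := by
    intro z hz
    fun_prop
  refine hf.eqOn_of_preconnected_of_eventuallyEq hg isPreconnected_Ioo
    (z₀ := 1 / 10) (by norm_num) ?_ hx
  filter_upwards [Ioo_mem_nhds (show (0 : ℝ) < 1 / 10 by norm_num)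
    (show (1 / 10 : ℝ) < 1 / 8 by norm_num)] with z hz
  have h := (tl_small z hz.1.le hz.2.le).mul_left (Real.exp z)
  rw [mul_one] at h
  rw [tlG, ← h.tsum_eq]
  congr 1
  funext k
  rw [mul_pow, ← Real.exp_nat_mul]
  have : Real.exp (-((k + 1) * z)) = Real.exp (k * -z) * Real.exp (-z) := by
    rw [← Real.exp_add]; congr 1; ring
  rw [this, Real.exp_neg z]
  field_simp

lemma tl_hasSum_Ioo (x : ℝ) (hx : x ∈ Set.Ioo (0 : ℝ) 1) :
    HasSum (fun k => tlc k * (x * Real.exp (-x)) ^ k) (Real.exp x) := by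
  have hx0 := hx.1
  have := (tlc_summable (x * Real.exp (-x)) (by positivity) (tl_lt x hx.2.ne)).hasSum
  rwa [← tlG, tlG_Ioo x hx] at this

lemma tl_hasSum_one :
    HasSum (fun k => tlc k * ((1 : ℝ) * Real.exp (-1)) ^ k) (Real.exp 1) := by
  have hnn : ∀ k, 0 ≤ tlc k * ((1 : ℝ) * Real.exp (-1)) ^ k :=
    fun k => mul_nonneg (tlc_nonneg k) (by positivity)
  have hev : ∀ᶠ x : ℝ in nhdsWithin 1 (Set.Iio 1), x ∈ Set.Ioo (0 : ℝ) 1 :=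
    Ioo_mem_nhdsLT (by norm_num)
  have hle : ∀ n, ∑ k ∈ Finset.range n, tlc k * ((1 : ℝ) * Real.exp (-1)) ^ k ≤ Real.exp 1 := by
    intro n
    have hc : Continuous (fun x : ℝ => ∑ k ∈ Finset.range n, tlc k * (x * Real.exp (-x)) ^ k) := by
      fun_prop
    refine le_of_tendsto (x := nhdsWithin 1 (Set.Iio 1)) ((hc.tendsto 1).mono_left nhdsWithin_le_nhds) ?_
    filter_upwards [hev] with x hx
    have hx0 := hx.1
    refine (sum_le_hasSum _ (fun k _ => mul_nonneg (tlc_nonneg k) (by positivity))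
      (tl_hasSum_Ioo x hx)).trans (Real.exp_le_exp.2 hx.2.le)
  have hs := summable_of_sum_range_le hnn hle
  have heq : ∑' k, tlc k * ((1 : ℝ) * Real.exp (-1)) ^ k = Real.exp 1 := by
    apply le_antisymm (Real.tsum_le_of_sum_range_le hnn hle)
    refine le_of_tendsto (x := nhdsWithin 1 (Set.Iio 1)) ((Real.continuous_exp.tendsto 1).mono_left nhdsWithin_le_nhds)
      ?_
    filter_upwards [hev] with x hx
    have hx0 := hx.1
    refine hasSum_le (fun k => ?_) (tl_hasSum_Ioo x hx) hs.hasSum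
    refine mul_le_mul_of_nonneg_left (pow_le_pow_left₀ (by positivity) ?_ k) (tlc_nonneg k)
    have := tl_lt x hx.2.ne
    rw [one_mul, Real.exp_neg 1, ← one_div, le_div_iff₀ (Real.exp_pos 1)]
    linarith
  rw [← heq]
  exact hs.hasSum

/-- For every real `x` with `0 ≤ x ≤ 1`, the series
`∑_{k=1}^∞ (k^{k-1}/k!) x^{k-1} e^{-kx}` converges and its sum equals `1`
(below the sum over `k ≥ 1` is written as a sum over `k ∈ ℕ` shifted by one). -/
theorem sum_treeLike_series_eq_one (x : ℝ) (hx : x ∈ Set.Icc (0 : ℝ) 1) :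
    HasSum (fun k : ℕ =>
      ((k : ℝ) + 1) ^ k / (Nat.factorial (k + 1)) * x ^ k * Real.exp (-((k + 1) * x))) 1 := by
  rcases hx.1.eq_or_lt with h0 | h0
  · exact tl_small x hx.1 (by rw [← h0]; norm_num)
  have h : HasSum (fun k => tlc k * (x * Real.exp (-x)) ^ k) (Real.exp x) := by
    rcases hx.2.eq_or_lt with h1 | h1
    · rw [h1]; exact tl_hasSum_one
    · exact tl_hasSum_Ioo x ⟨h0, h1⟩
  have h2 := h.mul_left (Real.exp (-x))
  rw [← Real.exp_add, neg_add_cancel, Real.exp_zero] at h2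
  refine (congrArg (fun f : ℕ → ℝ => HasSum f 1) (funext fun k => ?_)).mpr h2
  have : Real.exp (-((k + 1) * x)) = Real.exp (k * -x) * Real.exp (-x) := by
    rw [← Real.exp_add]; congr 1; ring
  rw [this, mul_pow, ← Real.exp_nat_mul, tlc]
  ring
end

section
/- For every real x with 0 ≤ x ≤ 1, Σ_{k=1}^{∞} (k^{k−1}/k!) (x e^{−x})^k = x. Equivalently, the power series h(y) := Σ_{k=1}^{∞} (k^{k−1}/k!) y^k, y ∈ [0, e^{−1}], is the inverse function of the restriction to [0, 1] of the map g(x) = x e^{−x}. -/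
open Real

lemma hs_congr {f g : ℕ → ℝ} {a b : ℝ} (h : HasSum f a) (hf : ∀ k, g k = f k) (hb : b = a) :
    HasSum g b := by
  rw [hb, funext hf]
  exact h

noncomputable def tcoef (k : ℕ) : ℝ := ((k : ℝ) + 1) ^ k / (Nat.factorial (k + 1))

lemma tcoef_nonneg (k : ℕ) : 0 ≤ tcoef k := by unfold tcoef; positivity

lemma tcoef_le (k : ℕ) : tcoef k ≤ Real.exp 1 ^ (k + 1) := by
  have h := Real.pow_div_factorial_le_exp (x := (k : ℝ) + 1) (by positivity) (k + 1)
  have h2 : tcoef k ≤ ((k : ℝ) + 1) ^ (k + 1) / (Nat.factorial (k + 1)) := by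
    unfold tcoef
    gcongr
    · linarith [(Nat.cast_nonneg k : (0 : ℝ) ≤ k)]
    · omega
  refine h2.trans (h.trans (le_of_eq ?_))
  rw [← Real.exp_nat_mul]
  push_cast
  ring_nf

lemma diff_sum (n : ℕ) (hn : 1 ≤ n) :
    ∑ k ∈ Finset.range (n + 1),
      (-1 : ℝ) ^ (n - k) * ((n + 1).choose (k + 1) : ℝ) * ((k : ℝ) + 1) ^ n = 0 := by
  have h := congrFun (fwdDiff_iter_pow_eq_zero_of_lt (R := ℝ) (Nat.lt_succ_self n)) 0
  rw [fwdDiff_iter_eq_sum_shift, Finset.sum_range_succ'] at h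
  have hn0 : n ≠ 0 := by omega
  simpa [hn0] using h

noncomputable def tF (x : ℝ) (p : ℕ × ℕ) : ℝ :=
  tcoef p.1 * x ^ (p.1 + 1) * ((-((p.1 : ℝ) + 1) * x) ^ p.2 / (Nat.factorial p.2))

lemma exp_hasSum (y : ℝ) : HasSum (fun m : ℕ => y ^ m / (Nat.factorial m : ℝ)) (Real.exp y) := by
  rw [Real.exp_eq_exp_ℝ]
  exact NormedSpace.expSeries_div_hasSum_exp y

lemma tF_row (x : ℝ) (k : ℕ) :
    HasSum (fun m => tF x (k, m)) (tcoef k * (x * Real.exp (-x)) ^ (k + 1)) := by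
  have h := (exp_hasSum (-((k : ℝ) + 1) * x)).mul_left (tcoef k * x ^ (k + 1))
  refine hs_congr h (fun m => rfl) ?_
  rw [mul_pow, ← Real.exp_nat_mul]
  push_cast
  ring_nf

lemma tF_norm_row (x : ℝ) (hx : 0 ≤ x) (k : ℕ) :
    HasSum (fun m => ‖tF x (k, m)‖) (tcoef k * (x * Real.exp x) ^ (k + 1)) := by
  have h := (exp_hasSum (((k : ℝ) + 1) * x)).mul_left (tcoef k * x ^ (k + 1))
  refine hs_congr h (fun m => ?_) ?_
  · have : 0 ≤ (k : ℝ) + 1 := by positivity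
    simp only [tF, norm_mul, norm_div, norm_pow, norm_neg, Real.norm_eq_abs, abs_of_nonneg hx,
      abs_of_nonneg (tcoef_nonneg k), abs_of_nonneg this, Nat.abs_cast]
  · rw [mul_pow, ← Real.exp_nat_mul]
    push_cast
    ring_nf

lemma tF_summable (x : ℝ) (hx : 0 ≤ x) (hx1 : Real.exp 1 * (x * Real.exp x) < 1) :
    Summable (tF x) := by
  apply Summable.of_norm
  rw [summable_prod_of_nonneg (fun _ => norm_nonneg _)]
  refine ⟨fun k => (tF_norm_row x hx k).summable, ?_⟩
  simp_rw [fun k => (tF_norm_row x hx k).tsum_eq]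
  have hy : 0 ≤ x * Real.exp x := by positivity
  have hg : Summable (fun k : ℕ => (Real.exp 1 * (x * Real.exp x)) ^ (k + 1)) :=
    (summable_nat_add_iff 1).2 (summable_geometric_of_lt_one (by positivity) hx1)
  refine hg.of_nonneg_of_le (fun k => mul_nonneg (tcoef_nonneg k) (by positivity)) (fun k => ?_)
  rw [mul_pow (Real.exp 1)]
  gcongr
  exact tcoef_le k

lemma tF_antidiag (x : ℝ) (n : ℕ) :
    ∑ p ∈ Finset.HasAntidiagonal.antidiagonal n, tF x p = if n = 0 then x else 0 := by
  rw [Finset.Nat.sum_antidiagonal_eq_sum_range_succ_mk]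
  split_ifs with h
  · subst h
    simp [tF, tcoef]
  · have h0 := diff_sum n (by omega)
    have key : ∀ k ∈ Finset.range (n + 1), tF x (k, n - k) =
        (x ^ (n + 1) / (Nat.factorial (n + 1))) *
        ((-1 : ℝ) ^ (n - k) * ((n + 1).choose (k + 1) : ℝ) * ((k : ℝ) + 1) ^ n) := by
      intro k hk
      have hk' : k ≤ n := by simpa [Nat.lt_succ_iff] using hk
      obtain ⟨m, rfl⟩ := Nat.exists_eq_add_of_le hk'
      have hc : ((k + m + 1).choose (k + 1) : ℝ) =
          (Nat.factorial (k + m + 1)) / ((Nat.factorial (k + 1)) * (Nat.factorial m)) := by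
        rw [Nat.cast_choose ℝ (by omega : k + 1 ≤ k + m + 1)]
        congr 4
        omega
      have h1 : (Nat.factorial (k + m + 1) : ℝ) ≠ 0 := by positivity
      have h2 : (Nat.factorial (k + 1) : ℝ) ≠ 0 := by positivity
      have h3 : (Nat.factorial m : ℝ) ≠ 0 := by positivity
      rw [hc, Nat.add_sub_cancel_left]
      simp only [tF, tcoef]
      rw [neg_mul, neg_pow, mul_pow]
      field_simp
      ring
    rw [Finset.sum_congr rfl key, ← Finset.mul_sum, h0, mul_zero]

lemma small_case (x : ℝ) (hx : 0 ≤ x) (hx1 : Real.exp 1 * (x * Real.exp x) < 1) :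
    HasSum (fun k : ℕ => tcoef k * (x * Real.exp (-x)) ^ (k + 1)) x := by
  obtain ⟨S, hS⟩ := tF_summable x hx hx1
  have h1 := hS.prod_fiberwise (tF_row x)
  have h2 := (Finset.HasAntidiagonal.sigmaAntidiagonalEquivProd (A := ℕ)).hasSum_iff.2 hS
  have h3 : HasSum (fun n : ℕ => if n = 0 then x else 0) S := by
    refine h2.sigma (fun n => ?_)
    rw [← tF_antidiag x n]
    exact Finset.hasSum (Finset.HasAntidiagonal.antidiagonal n) (tF x)
  have h4 : HasSum (fun n : ℕ => if n = 0 then x else 0) x := hasSum_ite_eq 0 x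
  rwa [h3.unique h4] at h1

lemma small_bound (x : ℝ) (hx : 0 < x) (hx1 : x < 1 / 5) :
    Real.exp 1 * (x * Real.exp x) < 1 := by
  have h1 := Real.exp_one_lt_d9
  have h2 : Real.exp x ≤ 5 / 4 := by
    have h3 := Real.add_one_le_exp (-x)
    have h4 : Real.exp x * Real.exp (-x) = 1 := by rw [← Real.exp_add]; simp
    nlinarith [Real.exp_pos x]
  have h5 : x * Real.exp x ≤ 1 / 5 * (5 / 4) := by gcongr
  nlinarith [Real.exp_pos 1, mul_pos hx (Real.exp_pos x)]

noncomputable def tser : FormalMultilinearSeries ℝ ℝ ℝ :=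
  FormalMultilinearSeries.ofScalars ℝ tcoef

noncomputable def trad : NNReal := ⟨Real.exp (-1), (Real.exp_pos _).le⟩

lemma tser_radius : (trad : ENNReal) ≤ tser.radius := by
  apply FormalMultilinearSeries.le_radius_of_bound _ (Real.exp 1)
  intro n
  rw [tser, FormalMultilinearSeries.ofScalars_norm, Real.norm_of_nonneg (tcoef_nonneg n)]
  change tcoef n * Real.exp (-1) ^ n ≤ _
  calc tcoef n * Real.exp (-1) ^ n ≤ Real.exp 1 ^ (n + 1) * Real.exp (-1) ^ n := by
        gcongr; exact tcoef_le n
    _ = Real.exp 1 * (Real.exp 1 * Real.exp (-1)) ^ n := by ring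
    _ = Real.exp 1 := by rw [← Real.exp_add]; simp

lemma tser_ball : HasFPowerSeriesOnBall tser.sum tser 0 tser.radius := by
  apply FormalMultilinearSeries.hasFPowerSeriesOnBall
  refine lt_of_lt_of_le ?_ tser_radius
  rw [ENNReal.coe_pos]
  exact Real.exp_pos (-1)

lemma g_mem (x : ℝ) (hx : x ∈ Set.Ico (0 : ℝ) 1) :
    x * Real.exp (-x) ∈ Metric.eball (0 : ℝ) tser.radius := by
  rw [Metric.mem_eball, edist_zero_right]
  refine lt_of_lt_of_le ?_ tser_radius
  rw [enorm_eq_nnnorm, ENNReal.coe_lt_coe, ← NNReal.coe_lt_coe, coe_nnnorm,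
    Real.norm_of_nonneg (mul_nonneg hx.1 (Real.exp_pos _).le)]
  change x * Real.exp (-x) < Real.exp (-1)
  have h := Real.add_one_lt_exp (x := x - 1) (by linarith [hx.2])
  have h2 : Real.exp (-1) = Real.exp (x - 1) * Real.exp (-x) := by
    rw [← Real.exp_add]; ring_nf
  rw [h2]
  gcongr
  linarith

lemma tser_hasSum (x : ℝ) (hx : x ∈ Set.Ico (0 : ℝ) 1) :
    HasSum (fun k : ℕ => tcoef k * (x * Real.exp (-x)) ^ (k + 1))
      (x * Real.exp (-x) * tser.sum (x * Real.exp (-x))) := by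
  have h := (tser_ball.hasSum (g_mem x hx)).mul_left (x * Real.exp (-x))
  rw [zero_add] at h
  refine hs_congr h (fun k => ?_) rfl
  rw [tser, FormalMultilinearSeries.ofScalars_apply_eq, smul_eq_mul]
  ring

lemma lt_one_case (x : ℝ) (hx : x ∈ Set.Ico (0 : ℝ) 1) :
    HasSum (fun k : ℕ => tcoef k * (x * Real.exp (-x)) ^ (k + 1)) x := by
  have hg : AnalyticOnNhd ℝ (fun x : ℝ => x * Real.exp (-x)) (Set.Ico (0 : ℝ) 1) := by
    intro x _
    fun_prop
  have hA : AnalyticOnNhd ℝ (fun x : ℝ => x * Real.exp (-x) * tser.sum (x * Real.exp (-x)))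
      (Set.Ico (0 : ℝ) 1) :=
    hg.mul (tser_ball.analyticOnNhd.comp hg g_mem)
  have hE := hA.eqOn_of_preconnected_of_eventuallyEq (g := fun x => x) (fun x _ => analyticAt_id)
    isPreconnected_Ico (z₀ := 1 / 10) (by norm_num) (by
      filter_upwards [Ioo_mem_nhds (show (0 : ℝ) < 1 / 10 by norm_num)
        (show (1 / 10 : ℝ) < 1 / 5 by norm_num)] with y hy
      exact (tser_hasSum y ⟨hy.1.le, by linarith [hy.2]⟩).unique
        (small_case y hy.1.le (small_bound y hy.1 hy.2)))
  have h := tser_hasSum x hx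
  exact hs_congr h (fun _ => rfl) (hE hx).symm

lemma one_case : HasSum (fun k : ℕ => tcoef k * ((1 : ℝ) * Real.exp (-1)) ^ (k + 1)) 1 := by
  have hnn : ∀ x : ℝ, 0 ≤ x → ∀ k : ℕ, 0 ≤ tcoef k * (x * Real.exp (-x)) ^ (k + 1) :=
    fun x hx k => mul_nonneg (tcoef_nonneg k) (by positivity)
  apply hasSum_of_isLUB_of_nonneg _ (hnn 1 zero_le_one)
  constructor
  · rintro _ ⟨s, rfl⟩
    have hc : Continuous (fun x : ℝ => ∑ k ∈ s, tcoef k * (x * Real.exp (-x)) ^ (k + 1)) := by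
      fun_prop
    have hle : ∀ᶠ x in nhdsWithin (1 : ℝ) (Set.Iio 1),
        ∑ k ∈ s, tcoef k * (x * Real.exp (-x)) ^ (k + 1) ≤ 1 := by
      filter_upwards [Ioo_mem_nhdsLT (show (0 : ℝ) < 1 by norm_num)] with x hx
      exact (sum_le_hasSum s (fun k _ => hnn x hx.1.le k)
        (lt_one_case x ⟨hx.1.le, hx.2⟩)).trans hx.2.le
    exact le_of_tendsto (hc.tendsto 1 |>.mono_left nhdsWithin_le_nhds) hle
  · intro b hb
    have hb0 : 0 ≤ b := by simpa using hb ⟨∅, rfl⟩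
    refine le_of_forall_lt_imp_le_of_dense (fun x hx => ?_)
    rcases lt_or_ge x 0 with h0 | h0
    · linarith
    refine hasSum_le_of_sum_le (lt_one_case x ⟨h0, hx⟩) (fun s => le_trans ?_ (hb ⟨s, rfl⟩))
    refine Finset.sum_le_sum (fun k _ => mul_le_mul_of_nonneg_left ?_ (tcoef_nonneg k))
    refine pow_le_pow_left₀ (by positivity) ?_ _
    rw [one_mul]
    exact Real.mul_exp_neg_le_exp_neg_one x

/-- For every real `x` with `0 ≤ x ≤ 1`,
`∑_{k=1}^∞ (k^{k-1}/k!) (x e^{-x})^k = x`; i.e. the power series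
`h(y) = ∑_{k=1}^∞ (k^{k-1}/k!) y^k` inverts `x ↦ x e^{-x}` on `[0, 1]`
(below the sum over `k ≥ 1` is written as a sum over `k ∈ ℕ` shifted by one). -/
theorem sum_treeFunction_inverse (x : ℝ) (hx : x ∈ Set.Icc (0 : ℝ) 1) :
    HasSum (fun k : ℕ =>
      ((k : ℝ) + 1) ^ k / (Nat.factorial (k + 1)) * (x * Real.exp (-x)) ^ (k + 1)) x := by
  rcases lt_or_eq_of_le hx.2 with h | h
  · exact lt_one_case x ⟨hx.1, h⟩
  · subst h
    exact one_case
end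

section
/- For x ≥ 0, t with x + t ≥ 0, and n ∈ ℕ⁺, define K_n(x, t) := { (y_1, ..., y_n) ∈ ℝ_+^n : y_1 + ... + y_i ≤ i x + t for all i = 1, ..., n }. Then the n-dimensional Lebesgue measure of K_n(x, t) equals (1/n!) (x + t) ((n+1) x + t)^{n−1}. -/
open MeasureTheory

def KK (n : ℕ) (x t : ℝ) : Set (Fin n → ℝ) :=
  {y : Fin n → ℝ | (∀ j, 0 ≤ y j) ∧
        ∀ i : Fin n, ∑ j ∈ Finset.Iic i, y j ≤ ((i : ℕ) + 1) * x + t}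

lemma KK_meas (n : ℕ) (x t : ℝ) : MeasurableSet (KK n x t) := by
  apply IsClosed.measurableSet
  unfold KK
  rw [Set.setOf_and, Set.setOf_forall, Set.setOf_forall]
  refine IsClosed.inter (isClosed_iInter fun j => ?_) (isClosed_iInter fun j => ?_)
  · exact isClosed_le (by fun_prop) (by fun_prop)
  · exact isClosed_le (by fun_prop) (by fun_prop)

lemma sum_Iic_cons (n : ℕ) (i : Fin n) (a : ℝ) (z : Fin n → ℝ) :
    ∑ j ∈ Finset.Iic i.succ, (Fin.cons a z : Fin (n+1) → ℝ) j
      = a + ∑ j ∈ Finset.Iic i, z j := by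
  have h : ∀ (m : ℕ) (k : Fin m), Finset.Iic k = Finset.univ.filter (fun j => j ≤ k) := by
    intro m k; ext; simp
  rw [h, h, Finset.sum_filter, Finset.sum_filter, Fin.sum_univ_succ]
  simp

lemma mem_KK_cons (n : ℕ) (x t a : ℝ) (z : Fin n → ℝ) :
    (Fin.cons a z : Fin (n+1) → ℝ) ∈ KK (n+1) x t ↔
      a ∈ Set.Icc 0 (x + t) ∧ z ∈ KK n x (x + t - a) := by
  have h0 : Finset.Iic (0 : Fin (n+1)) = {0} := by ext; simp
  simp only [KK, Set.mem_setOf_eq, Fin.forall_fin_succ, sum_Iic_cons, h0, Finset.sum_singleton,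
    Fin.cons_zero, Fin.cons_succ, Set.mem_Icc, Fin.val_succ, Fin.val_zero, Nat.cast_zero,
    Nat.cast_add, Nat.cast_one]
  constructor
  · rintro ⟨⟨h1, h2⟩, h3, h4⟩
    exact ⟨⟨h1, by linarith⟩, h2, fun i => by linarith [h4 i]⟩
  · rintro ⟨⟨h1, h3⟩, h2, h4⟩
    exact ⟨⟨h1, h2⟩, by linarith, fun i => by linarith [h4 i]⟩

lemma KK_step (n : ℕ) (x t : ℝ) :
    volume (KK (n+1) x t) = ∫⁻ a in Set.Icc 0 (x+t), volume (KK n x (x + t - a)) := by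
  have hp := (volume_preserving_piFinSuccAbove (fun _ : Fin (n+1) => ℝ) 0).symm
  rw [← hp.measure_preimage (KK_meas _ _ _).nullMeasurableSet, Measure.volume_eq_prod,
    Measure.prod_apply (hp.measurable (KK_meas _ _ _)), ← lintegral_indicator measurableSet_Icc]
  congr 1
  ext a
  have : (Prod.mk a ⁻¹' (⇑(MeasurableEquiv.piFinSuccAbove (fun _ : Fin (n+1) => ℝ) 0).symm ⁻¹'
      KK (n+1) x t)) = {z | a ∈ Set.Icc 0 (x + t) ∧ z ∈ KK n x (x + t - a)} := by
    ext z
    rw [Set.mem_setOf_eq, ← mem_KK_cons]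
    simp [MeasurableEquiv.piFinSuccAbove, Fin.insertNthEquiv]
  rw [this]
  by_cases ha : a ∈ Set.Icc 0 (x+t)
  · simp only [ha, true_and, Set.indicator_of_mem]; rfl
  · simp [ha]

lemma KK_vol (n : ℕ) (x : ℝ) (hx : 0 ≤ x) : ∀ t : ℝ, 0 ≤ x + t →
    volume (KK (n+1) x t) = ENNReal.ofReal
          ((1 / Nat.factorial (n+1)) * (x + t) * ((n + 2) * x + t) ^ n) := by
  induction n with
  | zero =>
    intro t ht
    have h : ∀ s, KK 0 x s = Set.univ := by intro s; ext; simp [KK]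
    rw [KK_step]
    simp [h, volume_pi, Measure.pi_univ]
  | succ n ih =>
    intro t ht
    rw [KK_step]
    have e : ∀ a ∈ Set.Icc 0 (x+t), volume (KK (n+1) x (x+t-a)) = ENNReal.ofReal
       ((1 / Nat.factorial (n+1)) * (x + (x + t - a)) * ((n + 2) * x + (x + t - a)) ^ n) :=
      fun a ha => ih _ (by linarith [ha.2])
    rw [setLIntegral_congr_fun measurableSet_Icc e, ← ofReal_integral_eq_lintegral_ofReal]
    · congr 1
      rw [integral_Icc_eq_integral_Ioc, ← intervalIntegral.integral_of_le ht]
      rw [intervalIntegral.integral_eq_sub_of_hasDerivAt (f := fun a =>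
        -((1 / Nat.factorial (n+2)) * (x + t - a) * ((n + 2) * x + (x + t - a)) ^ (n+1)))]
      · push_cast; ring
      · intro a _
        have h1 : HasDerivAt (fun a : ℝ => x + t - a) (-1) a := by
          simpa using (hasDerivAt_id a).const_sub (x+t)
        have h2 := ((h1.const_mul (1 / (Nat.factorial (n+2) : ℝ))).mul
          ((h1.const_add ((n+2)*x)).pow (n+1))).neg
        refine h2.congr_deriv ?_
        rw [Nat.factorial_succ (n+1)]
        have := Nat.factorial_ne_zero (n+1)
        push_cast
        field_simp
        simp only [add_tsub_cancel_right, Pi.pow_apply]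
        field_simp
        ring
      · apply Continuous.intervalIntegrable; fun_prop
    · apply Continuous.integrableOn_Icc; fun_prop
    · refine (ae_restrict_iff' measurableSet_Icc).2 (Filter.Eventually.of_forall fun a ha => ?_)
      have : 0 ≤ x + t - a := by linarith [ha.2]
      simp only [Pi.zero_apply]
      positivity

/-- For `x ≥ 0`, `t` with `x + t ≥ 0`, and `n ≥ 1`, the set
`K_n(x,t) = {y ∈ ℝ₊ⁿ : y_1 + ⋯ + y_i ≤ i x + t for all i = 1, …, n}` has
`n`-dimensional Lebesgue measure `(1/n!) (x + t) ((n+1) x + t)^{n-1}`. -/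
theorem volume_constrained_simplex (n : ℕ) (hn : 1 ≤ n) (x t : ℝ)
    (hx : 0 ≤ x) (hxt : 0 ≤ x + t) :
    volume {y : Fin n → ℝ | (∀ j, 0 ≤ y j) ∧
        ∀ i : Fin n, ∑ j ∈ Finset.Iic i, y j ≤ ((i : ℕ) + 1) * x + t}
      = ENNReal.ofReal
          ((1 / Nat.factorial n) * (x + t) * ((n + 1) * x + t) ^ (n - 1)) := by
  obtain ⟨m, rfl⟩ : ∃ m, n = m + 1 := ⟨n - 1, by omega⟩
  have h := KK_vol m x hx t hxt
  unfold KK at h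
  rw [h]
  congr 2
  push_cast
  ring
end

section
/- For every α ∈ [0, 1] and θ > 0, the function p(k; α, θ) := θ e^{−α(θ + k)} α^k (k + θ)^{k−1} / k!, k ∈ ℕ (with the convention 0^0 = 1), is a probability mass function on ℕ; that is, p(k; α, θ) ≥ 0 for all k and Σ_{k=0}^{∞} θ e^{−α(θ + k)} α^k (k + θ)^{k−1} / k! = 1. -/
open Real

noncomputable def gpA (θ : ℝ) (k : ℕ) : ℝ := θ * ((k : ℝ) + θ) ^ ((k : ℤ) - 1) / Nat.factorial k

lemma gpA_nonneg {θ : ℝ} (hθ : 0 < θ) (k : ℕ) : 0 ≤ gpA θ k := by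
  unfold gpA; positivity

lemma gpA_bound {θ : ℝ} (hθ : 0 < θ) (k : ℕ) : gpA θ k * Real.exp (-1) ^ k ≤ Real.exp θ := by
  have hk : 0 < (k : ℝ) + θ := by positivity
  have h1 := Real.pow_div_factorial_le_exp _ hk.le k
  have h2 : gpA θ k = θ / (k + θ) * (((k : ℝ) + θ) ^ k / Nat.factorial k) := by
    unfold gpA
    rw [zpow_sub₀ hk.ne', zpow_natCast, zpow_one]
    field_simp
  have h3 : θ / (k + θ) ≤ 1 := by
    rw [div_le_one hk]; have : (0 : ℝ) ≤ k := by positivity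
    linarith
  have h4 : gpA θ k ≤ Real.exp (k + θ) := by
    rw [h2]
    calc _ ≤ 1 * (((k : ℝ) + θ) ^ k / Nat.factorial k) := by gcongr
      _ ≤ _ := by rw [one_mul]; exact h1
  calc _ ≤ Real.exp (k + θ) * Real.exp (-1) ^ k := by gcongr
    _ = Real.exp θ := by
      rw [← Real.exp_nat_mul, ← Real.exp_add]; congr 1; ring

lemma gpA_summable {θ : ℝ} (hθ : 0 < θ) {x : ℝ} (hx0 : 0 ≤ x) (hx : x < Real.exp (-1)) :
    Summable (fun k => gpA θ k * x ^ k) := by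
  have he := Real.exp_pos (-1)
  have hs : Summable (fun k : ℕ => Real.exp θ * (x / Real.exp (-1)) ^ k) :=
    (summable_geometric_of_lt_one (by positivity) ((div_lt_one he).2 hx)).mul_left _
  refine Summable.of_nonneg_of_le (fun k => mul_nonneg (gpA_nonneg hθ k) (by positivity)) ?_ hs
  intro k
  have : gpA θ k * x ^ k = (gpA θ k * Real.exp (-1) ^ k) * (x / Real.exp (-1)) ^ k := by
    rw [div_pow]; field_simp
  rw [this]
  have := gpA_bound hθ k
  gcongr

lemma gp_term (α θ : ℝ) (k : ℕ) : θ * Real.exp (-(α * (θ + k))) * α ^ k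
        * ((k : ℝ) + θ) ^ ((k : ℤ) - 1) / Nat.factorial k
    = gpA θ k * (α * Real.exp (-α)) ^ k * Real.exp (-(α * θ)) := by
  have : Real.exp (-(α * (θ + k))) = Real.exp (-α) ^ k * Real.exp (-(α * θ)) := by
    rw [← Real.exp_nat_mul, ← Real.exp_add]; congr 1; ring
  rw [this, mul_pow]; unfold gpA; ring

lemma gp_diag {θ : ℝ} (hθ : 0 < θ) (α : ℝ) (n : ℕ) :
    ∑ q ∈ Finset.HasAntidiagonal.antidiagonal n,
      gpA θ q.1 * α ^ q.1 * ((-(α * (θ + q.1))) ^ q.2 / Nat.factorial q.2)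
      = if n = 0 then 1 else 0 := by
  rcases Nat.eq_zero_or_pos n with rfl | hn
  · simp [gpA, hθ.ne']
  · rw [if_neg hn.ne']
    obtain ⟨m, rfl⟩ : ∃ m, n = m + 1 := ⟨n - 1, by omega⟩
    have h := fwdDiff_iter_pow_eq_zero_of_lt (R := ℝ) (Nat.lt_succ_self m)
    have h' := congrFun h θ
    rw [fwdDiff_iter_eq_sum_shift] at h'
    rw [Finset.Nat.sum_antidiagonal_eq_sum_range_succ_mk]
    have : ∀ k ∈ Finset.range (m + 1).succ,
        gpA θ k * α ^ k * ((-(α * (θ + k))) ^ (m + 1 - k) / Nat.factorial (m + 1 - k))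
        = (θ * α ^ (m + 1) / Nat.factorial (m + 1)) *
          (((-1 : ℤ) ^ (m + 1 - k) * (m + 1).choose k) • (θ + k • (1 : ℝ)) ^ m) := by
      intro k hk
      have hkm : k ≤ m + 1 := by simpa [Nat.lt_succ_iff] using hk
      have hp : (k : ℝ) + θ ≠ 0 := by positivity
      have hc : (((m + 1).choose k : ℕ) : ℝ) = (m + 1).factorial / (k.factorial * (m + 1 - k).factorial) :=
        Nat.cast_choose ℝ hkm
      have e1 : (-(α * (θ + k))) ^ (m + 1 - k)
          = (-1) ^ (m + 1 - k) * α ^ (m + 1 - k) * (k + θ) ^ (m + 1 - k) := by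
        rw [← mul_pow, ← mul_pow]; congr 1; ring
      have e2 : α ^ (m + 1) = α ^ k * α ^ (m + 1 - k) := by
        rw [← pow_add]; congr 1; omega
      have e3 : ((k : ℝ) + θ) ^ ((k : ℤ) - 1) * (k + θ) ^ (m + 1 - k) = (θ + k) ^ m := by
        rw [← zpow_natCast, ← zpow_add₀ hp, add_comm θ, ← zpow_natCast]; congr 1
        push_cast [hkm]; ring
      rw [zsmul_eq_mul]
      push_cast
      rw [nsmul_one, hc, e1, e2, ← e3]
      unfold gpA
      have f1 : ((m + 1).factorial : ℝ) ≠ 0 := by positivity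
      field_simp
    rw [Finset.sum_congr rfl this, ← Finset.mul_sum]
    simp only [Nat.succ_eq_add_one, Pi.zero_apply] at h' ⊢
    rw [h', mul_zero]

lemma gp_small {θ : ℝ} (hθ : 0 < θ) {α : ℝ} (h0 : 0 ≤ α) (h1 : α < 1 / 10) :
    HasSum (fun k : ℕ => gpA θ k * (α * Real.exp (-α)) ^ k * Real.exp (-(α * θ))) 1 := by
  have hx : α * Real.exp α < Real.exp (-1) := by
    have h2 : Real.exp α * Real.exp 1 ≤ Real.exp 1 * Real.exp 1 := by
      gcongr; linarith
    have h3 := Real.exp_one_lt_d9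
    have h5 : Real.exp 1 * Real.exp 1 < 10 := by nlinarith [Real.exp_pos 1]
    have h6 : α * Real.exp α * Real.exp 1 < 1 := by
      have := Real.exp_pos α
      have := Real.exp_pos 1
      nlinarith [mul_pos (Real.exp_pos α) (Real.exp_pos 1)]
    rw [Real.exp_neg, ← one_div, lt_div_iff₀ (Real.exp_pos 1)]
    exact h6
  set F : ℕ × ℕ → ℝ := fun q =>
    gpA θ q.1 * α ^ q.1 * ((-(α * (θ + q.1))) ^ q.2 / Nat.factorial q.2) with hF
  have hexp : ∀ y : ℝ, HasSum (fun m : ℕ => y ^ m / Nat.factorial m) (Real.exp y) := by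
    intro y
    rw [Real.exp_eq_exp_ℝ]
    exact NormedSpace.expSeries_div_hasSum_exp y
  have hn : ∀ q, ‖F q‖ = gpA θ q.1 * α ^ q.1 * ((α * (θ + q.1)) ^ q.2 / Nat.factorial q.2) := by
    intro q
    have : (0 : ℝ) ≤ θ + q.1 := by positivity
    simp only [hF, norm_mul, norm_div, norm_pow, norm_neg, Real.norm_eq_abs, abs_of_nonneg this,
      abs_of_nonneg (gpA_nonneg hθ q.1), abs_of_nonneg h0, Nat.abs_cast]
  have hsum : Summable F := by
    apply Summable.of_norm
    rw [summable_prod_of_nonneg (fun q => norm_nonneg _)]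
    simp only [hn]
    refine ⟨fun k => ((hexp _).summable).mul_left _, ?_⟩
    simp only [tsum_mul_left, (hexp _).tsum_eq]
    refine ((gpA_summable hθ (by positivity) hx).mul_right (Real.exp (α * θ))).congr ?_
    intro k
    have : Real.exp (α * (θ + k)) = Real.exp α ^ k * Real.exp (α * θ) := by
      rw [← Real.exp_nat_mul, ← Real.exp_add]; congr 1; ring
    rw [this, mul_pow]; ring
  have hS := hsum.hasSum
  have hA : HasSum (fun k : ℕ => gpA θ k * (α * Real.exp (-α)) ^ k * Real.exp (-(α * θ)))
      (∑' q, F q) := by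
    have := hS.prod_fiberwise (fun k => (hexp (-(α * (θ + k)))).mul_left (gpA θ k * α ^ k))
    convert this using 2 with k
    have : Real.exp (-(α * (θ + k))) = Real.exp (-α) ^ k * Real.exp (-(α * θ)) := by
      rw [← Real.exp_nat_mul, ← Real.exp_add]; congr 1; ring
    rw [this, mul_pow]; ring
  have hB : HasSum (fun n : ℕ => if n = 0 then (1 : ℝ) else 0) (∑' q, F q) := by
    have := (Finset.HasAntidiagonal.sigmaAntidiagonalEquivProd (A := ℕ)).hasSum_iff.2 hS
    have := this.sigma (fun n => hasSum_fintype _)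
    convert this using 2 with n
    rw [← gp_diag hθ α n, ← Finset.sum_finset_coe]
    rfl
  have := hB.unique (hasSum_ite_eq 0 (1 : ℝ))
  rwa [this] at hA

lemma gp_lt {α : ℝ} (h : α ≠ 1) : α * Real.exp (-α) < Real.exp (-1) := by
  have := Real.add_one_lt_exp (sub_ne_zero.2 h)
  have h2 : Real.exp (-1) = Real.exp (α - 1) * Real.exp (-α) := by
    rw [← Real.exp_add]; congr 1; ring
  rw [h2]
  have := Real.exp_pos (-α)
  gcongr
  linarith

lemma gp_lt_one {θ : ℝ} (hθ : 0 < θ) {α : ℝ} (h0 : 0 ≤ α) (h1 : α < 1) :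
    HasSum (fun k : ℕ => gpA θ k * (α * Real.exp (-α)) ^ k * Real.exp (-(α * θ))) 1 := by
  rcases h0.eq_or_lt with rfl | h0
  · exact gp_small hθ le_rfl (by norm_num)
  have hs := gpA_summable hθ (x := α * Real.exp (-α)) (by positivity) (gp_lt h1.ne)
  have hs' := (hs.mul_right (Real.exp (-(α * θ)))).hasSum
  rw [tsum_mul_right] at hs'
  set P := FormalMultilinearSeries.ofScalars ℝ (gpA θ)
  have hPs : ∀ x, P.sum x = ∑' k, gpA θ k * x ^ k := fun x =>
    FormalMultilinearSeries.ofScalars_sum_eq (gpA θ) x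
  have hr : ENNReal.ofReal (Real.exp (-1)) ≤ P.radius := by
    apply P.le_radius_of_bound (Real.exp θ)
    intro n
    rw [FormalMultilinearSeries.ofScalars_norm, Real.norm_of_nonneg (gpA_nonneg hθ n),
      Real.coe_toNNReal _ (Real.exp_pos _).le]
    exact gpA_bound hθ n
  have hrpos : 0 < P.radius := lt_of_lt_of_le (by simp [Real.exp_pos]) hr
  have hPa := (P.hasFPowerSeriesOnBall hrpos).analyticOnNhd
  have hf : AnalyticOnNhd ℝ (fun a => P.sum (a * Real.exp (-a)) * Real.exp (-(a * θ)))
      (Set.Ioo 0 1) := by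
    intro a ha
    have h1 : AnalyticAt ℝ P.sum (a * Real.exp (-a)) := by
      apply hPa
      rw [Metric.mem_eball, edist_dist, dist_zero_right]
      refine lt_of_lt_of_le ?_ hr
      rw [ENNReal.ofReal_lt_ofReal_iff (Real.exp_pos _),
        Real.norm_of_nonneg (mul_nonneg ha.1.le (Real.exp_pos _).le)]
      exact gp_lt ha.2.ne
    have h2 : AnalyticAt ℝ (fun a : ℝ => a * Real.exp (-a)) a := by fun_prop
    have h3 : AnalyticAt ℝ (fun a : ℝ => Real.exp (-(a * θ))) a := by fun_prop
    exact (AnalyticAt.comp' (f := fun a : ℝ => a * Real.exp (-a)) h1 h2).mul h3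
  have hE := hf.eqOn_of_preconnected_of_eventuallyEq (g := fun _ => 1) analyticOnNhd_const
    isPreconnected_Ioo (z₀ := 1 / 20) (by norm_num) (by
      filter_upwards [Ioo_mem_nhds (show (0 : ℝ) < 1 / 20 by norm_num)
        (show (1 / 20 : ℝ) < 1 / 10 by norm_num)] with a ha
      have := (gp_small hθ ha.1.le ha.2).tsum_eq
      rw [tsum_mul_right] at this
      rw [hPs, this])
  have := hE ⟨h0, h1⟩
  simp only [hPs] at this
  rwa [this] at hs'

lemma gp_one {θ : ℝ} (hθ : 0 < θ) :
    HasSum (fun k : ℕ => gpA θ k * (1 * Real.exp (-1)) ^ k * Real.exp (-(1 * θ))) 1 := by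
  set f : ℝ → ℕ → ℝ := fun α k => gpA θ k * (α * Real.exp (-α)) ^ k * Real.exp (-(α * θ)) with hf
  have hc : ∀ k, Continuous (fun α => f α k) := by intro k; simp only [hf]; fun_prop
  have hpos : ∀ α, 0 ≤ α → ∀ k, 0 ≤ f α k := fun α h k =>
    mul_nonneg (mul_nonneg (gpA_nonneg hθ k) (by positivity)) (by positivity)
  have hev : ∀ᶠ α in nhdsWithin (1 : ℝ) (Set.Iio 1), α ∈ Set.Ioo (0 : ℝ) 1 :=
    Ioo_mem_nhdsLT (by norm_num)
  have hs : Summable (f 1) := by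
    apply summable_of_sum_le (c := 1) (hpos 1 zero_le_one)
    intro u
    have hcu : Continuous (fun α => ∑ k ∈ u, f α k) := continuous_finset_sum _ (fun k _ => hc k)
    refine le_of_tendsto (hcu.continuousAt.tendsto.mono_left (nhdsWithin_le_nhds (s := Set.Iio 1))) ?_
    filter_upwards [hev] with α ha
    exact sum_le_hasSum _ (fun k _ => hpos α ha.1.le k) (gp_lt_one hθ ha.1.le ha.2)
  have hb : Summable (fun k => gpA θ k * Real.exp (-1) ^ k) := by
    refine (hs.mul_right (Real.exp θ)).congr ?_
    intro k
    simp only [hf, one_mul]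
    rw [mul_assoc, ← Real.exp_add]; simp
  have ht := tendsto_tsum_of_dominated_convergence (𝓕 := nhdsWithin (1 : ℝ) (Set.Iio 1))
    (f := f) (g := f 1) hb
    (fun k => (hc k).continuousAt.tendsto.mono_left nhdsWithin_le_nhds) (by
      filter_upwards [hev] with α ha k
      rw [Real.norm_of_nonneg (hpos α ha.1.le k)]
      have h1 : Real.exp (-(α * θ)) ≤ 1 := by
        rw [Real.exp_le_one_iff]; have := mul_pos ha.1 hθ; linarith
      have h2 := (gp_lt ha.2.ne).le
      have h3 := gpA_nonneg hθ k
      have h4 := ha.1.le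
      calc f α k ≤ gpA θ k * Real.exp (-1) ^ k * 1 := by
            simp only [hf]; gcongr
        _ = _ := mul_one _)
  have ht' : Filter.Tendsto (fun α => ∑' k, f α k) (nhdsWithin (1 : ℝ) (Set.Iio 1)) (nhds 1) := by
    refine tendsto_const_nhds.congr' ?_
    filter_upwards [hev] with α ha
    exact (gp_lt_one hθ ha.1.le ha.2).tsum_eq.symm
  have := tendsto_nhds_unique ht ht'
  have h := hs.hasSum
  rwa [this] at h


/-- For every `α ∈ [0, 1]` and `θ > 0`, the function
`p(k) = θ e^{-α(θ+k)} α^k (k+θ)^{k-1} / k!` on `ℕ` (with `0^0 = 1`, and where the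
exponent `k - 1` is an integer, equal to `-1` for `k = 0`) is a probability mass
function: it is nonnegative and sums to `1`. -/
theorem generalizedPoisson_pmf (α θ : ℝ) (hα : α ∈ Set.Icc (0 : ℝ) 1) (hθ : 0 < θ) :
    (∀ k : ℕ, 0 ≤ θ * Real.exp (-(α * (θ + k))) * α ^ k
        * ((k : ℝ) + θ) ^ ((k : ℤ) - 1) / Nat.factorial k) ∧
    HasSum (fun k : ℕ => θ * Real.exp (-(α * (θ + k))) * α ^ k
        * ((k : ℝ) + θ) ^ ((k : ℤ) - 1) / Nat.factorial k) 1 := by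
  simp only [gp_term]
  obtain ⟨h0, h1⟩ := hα
  refine ⟨fun k => mul_nonneg (mul_nonneg (gpA_nonneg hθ k) (by positivity)) (by positivity), ?_⟩
  rcases h1.eq_or_lt with rfl | h1
  · exact gp_one hθ
  · exact gp_lt_one hθ h0 h1
end
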